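/- Let m_{i,j} : ℝ → ℝ and α_i : ℝ → ℝ (i, j ∈ ℕ) be twice differentiable functions of t satisfying m_{i,j} = −m_{j,i}, m_{i,j}′ = m_{i+1,j} + m_{i,j+1}, α_i′ = α_{i+1}, and the rank two shift condition m_{i+1,j} + m_{i,j+1} = α_{i+1}·α_j − α_i·α_{j+1} for all i, j. Define τ̂_0 = 1, τ̂_{2n} = Pf((m_{i,j})_{i,j=0}^{2n−1}), and τ̂_{2n+1} = Pf of (m_{i,j})_{i,j=0}^{2n} bordered by the row (α_0, …, α_{2n}). Then the B-Toda lattice holds: for every n ≥ 1 and all t, τ̂_n″·τ̂_n − (τ̂_n′)² = τ̂_{n−1}′·τ̂_{n+1} − τ̂_{n−1}·τ̂_{n+1}′ (equivalently, in Hirota form, D_{t₁}² τ̂_n · τ̂_n = 2 D_{t₁} τ̂_{n−1} · τ̂_{n+1}). -/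

import Mathlib

/-- The Pfaffian of a 2N×2N matrix over a commutative ℚ-algebra:
`Pf(A) = (1/(2^N N!)) Σ_{π∈S_{2N}} sgn(π) ∏_{k=1}^N a_{π(2k−1),π(2k)}`. -/
noncomputable def pfaffian {R : Type*} [CommRing R] [Algebra ℚ R] {N : ℕ}
    (A : Matrix (Fin (2 * N)) (Fin (2 * N)) R) : R :=
  algebraMap ℚ R (1 / (2 ^ N * N.factorial : ℚ)) *
    ∑ π : Equiv.Perm (Fin (2 * N)), (Equiv.Perm.sign π : ℤ) •
      ∏ k : Fin N,
        A (π ⟨2 * (k : ℕ), by have := k.isLt; omega⟩)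
          (π ⟨2 * (k : ℕ) + 1, by have := k.isLt; omega⟩)

/-- `τ̂_{2n}(t) = Pf((m_{i,j}(t))_{i,j=0}^{2n−1})`; in particular `τ̂_0 = 1`. -/
noncomputable def tauEvenT (m : ℕ → ℕ → ℝ → ℝ) (n : ℕ) : ℝ → ℝ :=
  fun t => pfaffian (Matrix.of fun i j : Fin (2 * n) => m i j t)

/-- `τ̂_{2n+1}(t) = Pf` of `(m_{i,j}(t))_{i,j=0}^{2n}` bordered by the row
`(α_0(t), …, α_{2n}(t))`. -/
noncomputable def tauOddT (m : ℕ → ℕ → ℝ → ℝ) (α : ℕ → ℝ → ℝ) (n : ℕ) : ℝ → ℝ :=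
  fun t => pfaffian (Matrix.of fun i j : Fin (2 * (n + 1)) =>
    if (i : ℕ) = 0 then (if (j : ℕ) = 0 then 0 else α ((j : ℕ) - 1) t)
    else if (j : ℕ) = 0 then -α ((i : ℕ) - 1) t
    else m ((i : ℕ) - 1) ((j : ℕ) - 1) t)

/-- The combined tau function sequence: `τ̂_{2n} = tauEvenT n`, `τ̂_{2n+1} = tauOddT n`. -/
noncomputable def tauhatT (m : ℕ → ℕ → ℝ → ℝ) (α : ℕ → ℝ → ℝ) (n : ℕ) : ℝ → ℝ :=
  if n % 2 = 0 then tauEvenT m (n / 2) else tauOddT m α (n / 2)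

theorem pfaffian_submatrix_perm {N : ℕ} (A : Matrix (Fin (2 * N)) (Fin (2 * N)) ℝ)
    (σ : Equiv.Perm (Fin (2 * N))) :
    pfaffian (A.submatrix σ σ) = ((Equiv.Perm.sign σ : ℤ) : ℝ) * pfaffian A := by
  unfold pfaffian
  rw [mul_left_comm]
  congr 1
  rw [Finset.mul_sum, ← Equiv.sum_comp (Equiv.mulLeft σ)
    (fun π => ((Equiv.Perm.sign σ : ℤ) : ℝ) * _)]
  refine Finset.sum_congr rfl fun π _ => ?_
  have h : ((Equiv.Perm.sign σ : ℤ) : ℝ) * ((Equiv.Perm.sign σ : ℤ) : ℝ) = 1 := by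
    exact_mod_cast Int.units_coe_mul_self (Equiv.Perm.sign σ)
  simp only [zsmul_eq_mul, Equiv.coe_mulLeft, Equiv.Perm.sign_mul, Units.val_mul, Int.cast_mul,
    Matrix.submatrix_apply, Equiv.Perm.mul_apply]
  rw [← mul_assoc, ← mul_assoc, h, one_mul]

/-- The first index of the `k`-th consecutive pair. -/
def pairFst {N : ℕ} (k : Fin N) : Fin (2 * N) := ⟨2 * (k : ℕ), by have := k.isLt; omega⟩

/-- The second index of the `k`-th consecutive pair. -/
def pairSnd {N : ℕ} (k : Fin N) : Fin (2 * N) := ⟨2 * (k : ℕ) + 1, by have := k.isLt; omega⟩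

/-- The summand of the permutation expansion of the Pfaffian. -/
noncomputable def pfaffianTerm {N : ℕ} (A : Matrix (Fin (2 * N)) (Fin (2 * N)) ℝ)
    (π : Equiv.Perm (Fin (2 * N))) : ℝ :=
  (Equiv.Perm.sign π : ℤ) • ∏ k : Fin N, A (π (pairFst k)) (π (pairSnd k))

theorem pfaffian_eq_sum_pfaffianTerm {N : ℕ} (A : Matrix (Fin (2 * N)) (Fin (2 * N)) ℝ) :
    pfaffian A = 1 / (2 ^ N * (N.factorial : ℝ)) * ∑ π, pfaffianTerm A π := by
  unfold pfaffian
  congr 1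
  simp

theorem pfaffianTerm_mul_swap_pair {N : ℕ} (A : Matrix (Fin (2 * N)) (Fin (2 * N)) ℝ)
    (hA : ∀ i j, A i j = -A j i) (π : Equiv.Perm (Fin (2 * N))) (k : Fin N) :
    pfaffianTerm A (π * Equiv.swap (pairFst k) (pairSnd k)) = pfaffianTerm A π := by
  unfold pfaffianTerm
  have hne : pairFst k ≠ pairSnd k := by
    simp [Fin.ext_iff, pairFst, pairSnd]
  rw [Equiv.Perm.sign_mul, Equiv.Perm.sign_swap hne]
  have h : ∀ j : Fin N,
      A ((π * Equiv.swap (pairFst k) (pairSnd k)) (pairFst j))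
        ((π * Equiv.swap (pairFst k) (pairSnd k)) (pairSnd j)) =
      (if j = k then -1 else 1) * A (π (pairFst j)) (π (pairSnd j)) := by
    intro j
    rw [Equiv.Perm.mul_apply, Equiv.Perm.mul_apply]
    by_cases hj : j = k
    · subst hj
      rw [Equiv.swap_apply_left, Equiv.swap_apply_right, hA]
      simp
    · have hj' : (j : ℕ) ≠ k := fun h => hj (Fin.ext h)
      rw [Equiv.swap_apply_of_ne_of_ne, Equiv.swap_apply_of_ne_of_ne]
      · simp [hj]
      all_goals
        rw [Ne, Fin.ext_iff]
        simp only [pairFst, pairSnd]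
        omega
  simp only [h, Finset.prod_mul_distrib, Finset.prod_ite_eq', Finset.mem_univ, if_true]
  simp

theorem pairFst_injective {N : ℕ} : Function.Injective (pairFst (N := N)) := by
  intro i j h
  simpa [pairFst, Fin.ext_iff] using h

theorem pairSnd_injective {N : ℕ} : Function.Injective (pairSnd (N := N)) := by
  intro i j h
  simpa [pairSnd, Fin.ext_iff] using h

theorem pairFst_ne_pairSnd {N : ℕ} (i j : Fin N) : pairFst i ≠ pairSnd j := by
  rw [Ne, Fin.ext_iff]
  simp only [pairFst, pairSnd]
  omega

theorem swap_pairs_pairFst {N : ℕ} (i j k : Fin N) :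
    (Equiv.swap (pairFst i) (pairFst j) * Equiv.swap (pairSnd i) (pairSnd j)) (pairFst k) =
      pairFst (Equiv.swap i j k) := by
  rw [Equiv.Perm.mul_apply, Equiv.swap_apply_of_ne_of_ne (pairFst_ne_pairSnd _ _)
    (pairFst_ne_pairSnd _ _), pairFst_injective.map_swap]

theorem swap_pairs_pairSnd {N : ℕ} (i j k : Fin N) :
    (Equiv.swap (pairFst i) (pairFst j) * Equiv.swap (pairSnd i) (pairSnd j)) (pairSnd k) =
      pairSnd (Equiv.swap i j k) := by
  rw [Equiv.Perm.mul_apply, ← pairSnd_injective.map_swap,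
    Equiv.swap_apply_of_ne_of_ne (pairFst_ne_pairSnd _ _).symm (pairFst_ne_pairSnd _ _).symm]

theorem pfaffianTerm_mul_swap_swap {N : ℕ}
    (A : Matrix (Fin (2 * (N + 1))) (Fin (2 * (N + 1))) ℝ)
    (π : Equiv.Perm (Fin (2 * (N + 1)))) (k : Fin (N + 1)) :
    pfaffianTerm A (π * (Equiv.swap (pairFst 0) (pairFst k) *
      Equiv.swap (pairSnd 0) (pairSnd k))) = pfaffianTerm A π := by
  unfold pfaffianTerm
  congr 1
  · rw [Equiv.Perm.sign_mul, Equiv.Perm.sign_mul, Equiv.Perm.sign_swap', Equiv.Perm.sign_swap']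
    by_cases hk : (k : ℕ) = 0 <;> simp [Fin.ext_iff, hk, eq_comm, pairFst, pairSnd]
  · rw [← Equiv.prod_comp (Equiv.swap 0 k) (fun j : Fin (N + 1) =>
      A (π (pairFst j)) (π (pairSnd j)))]
    refine Finset.prod_congr rfl fun j _ => ?_
    rw [Equiv.Perm.mul_apply π, Equiv.Perm.mul_apply π, swap_pairs_pairFst, swap_pairs_pairSnd]

theorem sum_pfaffianTerm_ite_apply_eq_zero {N : ℕ}
    (A : Matrix (Fin (2 * (N + 1))) (Fin (2 * (N + 1))) ℝ)
    (hA : ∀ i j, A i j = -A j i) (r : Fin (2 * (N + 1))) :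
    (∑ π : Equiv.Perm (Fin (2 * (N + 1))), if π r = pairFst 0 then pfaffianTerm A π else 0) =
    ∑ π : Equiv.Perm (Fin (2 * (N + 1))),
      if π (pairFst 0) = pairFst 0 then pfaffianTerm A π else 0 := by
  obtain ⟨σ, hσ, h0⟩ : ∃ σ : Equiv.Perm (Fin (2 * (N + 1))),
      (∀ π, pfaffianTerm A (π * σ) = pfaffianTerm A π) ∧ σ (pairFst 0) = r := by
    have key : ∀ k : Fin (N + 1), (Equiv.swap (pairFst 0) (pairFst k) *
        Equiv.swap (pairSnd 0) (pairSnd k)) (pairFst 0) = pairFst k := by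
      intro k
      rw [swap_pairs_pairFst, Equiv.swap_apply_left]
    have hr := r.isLt
    obtain ⟨k, hk | hk⟩ : ∃ k : Fin (N + 1), pairFst k = r ∨ pairSnd k = r := by
      rcases Nat.even_or_odd' (r : ℕ) with ⟨k, hk | hk⟩
      · exact ⟨⟨k, by omega⟩, Or.inl (Fin.ext hk.symm)⟩
      · exact ⟨⟨k, by omega⟩, Or.inr (Fin.ext hk.symm)⟩
    · exact ⟨_, fun π => pfaffianTerm_mul_swap_swap A π k, (key k).trans hk⟩
    · refine ⟨Equiv.swap (pairFst k) (pairSnd k) * (Equiv.swap (pairFst 0) (pairFst k) *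
        Equiv.swap (pairSnd 0) (pairSnd k)), fun π => ?_, ?_⟩
      · rw [← mul_assoc, pfaffianTerm_mul_swap_swap A _ k]
        exact pfaffianTerm_mul_swap_pair A hA π k
      · rw [Equiv.Perm.mul_apply, key, Equiv.swap_apply_left, hk]
  rw [← Equiv.sum_comp (Equiv.mulRight σ)
    (fun π => if π (pairFst 0) = pairFst 0 then pfaffianTerm A π else 0)]
  simp [hσ, h0]

theorem sum_pfaffianTerm {N : ℕ}
    (A : Matrix (Fin (2 * (N + 1))) (Fin (2 * (N + 1))) ℝ)
    (hA : ∀ i j, A i j = -A j i) :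
    ∑ π, pfaffianTerm A π = 2 * (N + 1) * ∑ π : Equiv.Perm (Fin (2 * (N + 1))),
      if π (pairFst 0) = pairFst 0 then pfaffianTerm A π else 0 := by
  have h : ∀ π : Equiv.Perm (Fin (2 * (N + 1))), pfaffianTerm A π =
      ∑ r, if π r = pairFst 0 then pfaffianTerm A π else 0 := by
    intro π
    rw [Equiv.sum_comp π (fun r => if r = pairFst 0 then pfaffianTerm A π else 0)]
    simp
  rw [Finset.sum_congr rfl fun π _ => h π, Finset.sum_comm,
    Finset.sum_congr rfl fun r _ => sum_pfaffianTerm_ite_apply_eq_zero A hA r]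
  simp

theorem pfaffianTerm_decomposeFin {N : ℕ}
    (A : Matrix (Fin (2 * N + 1 + 1)) (Fin (2 * N + 1 + 1)) ℝ)
    (q : Fin (2 * N + 1)) (e : Equiv.Perm (Fin (2 * N))) :
    pfaffianTerm (N := N + 1) A (Equiv.Perm.decomposeFin.symm
      ((0 : Fin (2 * N + 1 + 1)), Equiv.Perm.decomposeFin.symm (q, e))) =
      (if q = 0 then 1 else -1) * A 0 q.succ *
        pfaffianTerm (A.submatrix (fun i => (Equiv.swap 0 q i.succ).succ)
          (fun i => (Equiv.swap 0 q i.succ).succ)) e := by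
  have h0 : (pairFst (0 : Fin (N + 1)) : Fin (2 * N + 1 + 1)) = 0 := rfl
  have h1 : (pairSnd (0 : Fin (N + 1)) : Fin (2 * N + 1 + 1)) = (0 : Fin (2 * N + 1)).succ := rfl
  have h2 : ∀ k : Fin N, (pairFst k.succ : Fin (2 * N + 1 + 1)) = (pairFst k).succ.succ :=
    fun k => Fin.ext (by simp [pairFst]; ring)
  have h3 : ∀ k : Fin N, (pairSnd k.succ : Fin (2 * N + 1 + 1)) = (pairSnd k).succ.succ :=
    fun k => Fin.ext (by simp [pairSnd]; ring)
  unfold pfaffianTerm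
  have hs := Equiv.Perm.decomposeFin.symm_sign (0 : Fin (2 * N + 1 + 1))
    (Equiv.Perm.decomposeFin.symm (q, e))
  rw [Equiv.Perm.decomposeFin.symm_sign q e, if_pos rfl, one_mul] at hs
  rw [Fin.prod_univ_succ]
  erw [hs]
  have h4 : ∀ k : Fin N, A
      (Equiv.Perm.decomposeFin.symm ((0 : Fin (2 * N + 1 + 1)),
        Equiv.Perm.decomposeFin.symm (q, e)) (pairFst k.succ : Fin (2 * N + 1 + 1)))
      (Equiv.Perm.decomposeFin.symm ((0 : Fin (2 * N + 1 + 1)),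
        Equiv.Perm.decomposeFin.symm (q, e)) (pairSnd k.succ : Fin (2 * N + 1 + 1))) =
      (A.submatrix (fun i => (Equiv.swap 0 q i.succ).succ)
          (fun i => (Equiv.swap 0 q i.succ).succ)) (e (pairFst k)) (e (pairSnd k)) := by
    intro k
    rw [h2, h3]
    simp
  have h5 : A
      (Equiv.Perm.decomposeFin.symm ((0 : Fin (2 * N + 1 + 1)),
        Equiv.Perm.decomposeFin.symm (q, e)) (pairFst (0 : Fin (N + 1)) : Fin (2 * N + 1 + 1)))
      (Equiv.Perm.decomposeFin.symm ((0 : Fin (2 * N + 1 + 1)),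
        Equiv.Perm.decomposeFin.symm (q, e)) (pairSnd (0 : Fin (N + 1)) : Fin (2 * N + 1 + 1))) =
      A 0 q.succ := by
    rw [h0, h1]
    simp
  erw [h5, Finset.prod_congr rfl fun k _ => h4 k]
  split_ifs <;> simp [mul_left_comm]

theorem pfaffian_expand {N : ℕ}
    (A : Matrix (Fin (2 * N + 1 + 1)) (Fin (2 * N + 1 + 1)) ℝ)
    (hA : ∀ i j, A i j = -A j i) :
    pfaffian (N := N + 1) A = ∑ q : Fin (2 * N + 1), (-1) ^ (q : ℕ) * A 0 q.succ *
      pfaffian (A.submatrix (fun i => (q.succAbove i).succ) (fun i => (q.succAbove i).succ)) := by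
  have h1 : (∑ π : Equiv.Perm (Fin (2 * (N + 1))),
      if π (pairFst 0) = pairFst 0 then pfaffianTerm A π else 0) =
      ∑ q : Fin (2 * N + 1), ∑ e : Equiv.Perm (Fin (2 * N)),
        (if q = 0 then 1 else -1) * A 0 q.succ *
        pfaffianTerm (A.submatrix (fun i => (Equiv.swap 0 q i.succ).succ)
          (fun i => (Equiv.swap 0 q i.succ).succ)) e := by
    have hsum := Equiv.sum_comp (Equiv.Perm.decomposeFin (n := 2 * N + 1)).symm
      (fun π : Equiv.Perm (Fin (2 * N + 1 + 1)) =>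
        if π 0 = 0 then pfaffianTerm (N := N + 1) A π else 0)
    refine Eq.trans hsum.symm ?_
    rw [Fintype.sum_prod_type]
    simp only [Equiv.Perm.decomposeFin_symm_apply_zero]
    rw [Finset.sum_eq_single 0 (fun b _ hb => by simp [hb]) (by simp)]
    simp only [if_true]
    rw [← Equiv.sum_comp (Equiv.Perm.decomposeFin (n := 2 * N)).symm, Fintype.sum_prod_type]
    exact Finset.sum_congr rfl fun q _ => Finset.sum_congr rfl fun e _ =>
      pfaffianTerm_decomposeFin A q e
  rw [pfaffian_eq_sum_pfaffianTerm, sum_pfaffianTerm A hA, h1, Finset.mul_sum, Finset.mul_sum]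
  refine Finset.sum_congr rfl fun q _ => ?_
  have h2 : (if q = 0 then (1 : ℝ) else -1) *
      pfaffian (A.submatrix (fun i => (Equiv.swap 0 q i.succ).succ)
          (fun i => (Equiv.swap 0 q i.succ).succ)) = (-1) ^ (q : ℕ) *
      pfaffian (A.submatrix (fun i => (q.succAbove i).succ) (fun i => (q.succAbove i).succ)) := by
    induction q using Fin.cases with
    | zero => simp
    | succ j =>
      simp only [← Fin.succAbove_cycleRange]
      have := pfaffian_submatrix_perm (A.submatrix (fun i => (j.succ.succAbove i).succ)
        (fun i => (j.succ.succAbove i).succ)) j.cycleRange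
      rw [Matrix.submatrix_submatrix, Fin.sign_cycleRange] at this
      refine (congrArg _ this).trans ?_
      simp [pow_succ]
  have h3 : ∀ (a b c d e : ℝ), a * b = c * d → c * e * d = e * (a * b) := by
    intros a b c d e h
    rw [h]
    ring
  rw [h3 _ _ _ _ _ h2, pfaffian_eq_sum_pfaffianTerm, ← Finset.mul_sum, Nat.factorial_succ]
  push_cast
  field_simp
  ring

/-- The Pfaffian of the array `w (x i) (x j)` attached to a word `x` of arbitrary length, defined
by expansion along the first row; it vanishes on words of odd length. -/
noncomputable def wordPf {ι : Type*} (w : ι → ι → ℝ) : (n : ℕ) → (Fin n → ι) → ℝ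
  | 0, _ => 1
  | 1, _ => 0
  | n + 2, x => ∑ q : Fin (n + 1), (-1) ^ (q : ℕ) * w (x 0) (x q.succ) *
      wordPf w n (fun k => x (q.succAbove k).succ)

section wordPf

variable {ι : Type*} {w : ι → ι → ℝ}

theorem wordPf_cons {n : ℕ} (a : ι) (y : Fin (n + 1) → ι) :
    wordPf w (n + 2) (Fin.cons a y) = ∑ q : Fin (n + 1), (-1) ^ (q : ℕ) * w a (y q) *
      wordPf w n (fun k => y (q.succAbove k)) := by
  simp [wordPf]

theorem wordPf_odd : ∀ (N : ℕ) (x : Fin (2 * N + 1) → ι), wordPf w (2 * N + 1) x = 0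
  | 0, _ => rfl
  | N + 1, _ => Finset.sum_eq_zero fun _ _ =>
      (congrArg _ (wordPf_odd N _)).trans (mul_zero _)

theorem pfaffian_eq_wordPf (hw : ∀ a b, w a b = -w b a) : ∀ (N : ℕ) (x : Fin (2 * N) → ι),
    pfaffian (Matrix.of fun i j : Fin (2 * N) => w (x i) (x j)) = wordPf w (2 * N) x
  | 0, x => by simp [pfaffian, wordPf]
  | N + 1, x => by
      refine (pfaffian_expand (N := N) (Matrix.of fun i j => w (x i) (x j))
        (fun i j => hw _ _)).trans ?_
      refine Finset.sum_congr rfl fun q _ => ?_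
      exact congrArg (_ * ·) (pfaffian_eq_wordPf hw N fun k => x (q.succAbove k).succ)

theorem wordPf_comp_perm (hw : ∀ a b, w a b = -w b a) {n : ℕ} (x : Fin n → ι)
    (σ : Equiv.Perm (Fin n)) :
    wordPf w n (x ∘ σ) = ((Equiv.Perm.sign σ : ℤ) : ℝ) * wordPf w n x := by
  obtain ⟨N, rfl | rfl⟩ := Nat.even_or_odd' n
  · rw [← pfaffian_eq_wordPf hw, ← pfaffian_eq_wordPf hw, ← pfaffian_submatrix_perm]
    rfl
  · rw [wordPf_odd, wordPf_odd, mul_zero]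

theorem wordPf_comp_swap (hw : ∀ a b, w a b = -w b a) {n : ℕ} (x : Fin n → ι) {i j : Fin n}
    (hij : i ≠ j) : wordPf w n (x ∘ Equiv.swap i j) = -wordPf w n x := by
  rw [wordPf_comp_perm hw, Equiv.Perm.sign_swap hij]
  simp

theorem wordPf_eq_zero_of_eq (hw : ∀ a b, w a b = -w b a) {n : ℕ} (x : Fin n → ι) {i j : Fin n}
    (hij : i ≠ j) (h : x i = x j) : wordPf w n x = 0 := by
  have h1 := wordPf_comp_swap hw x hij
  have h2 : x ∘ Equiv.swap i j = x := by
    funext k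
    simp only [Function.comp_apply, Equiv.swap_apply_def]
    split_ifs with h3 h4
    · rw [h3, h]
    · rw [h4, h]
    · rfl
  rw [h2] at h1
  linarith

theorem wordPf_cons_eq_zero_of_mem (hw : ∀ a b, w a b = -w b a) {n : ℕ} (x : Fin n → ι)
    (i : Fin n) : wordPf w (n + 1) (Fin.cons (x i) x) = 0 :=
  wordPf_eq_zero_of_eq hw _ (Fin.succ_ne_zero i).symm (by simp)

theorem wordPf_cons_cons (hw : ∀ a b, w a b = -w b a) {n : ℕ} (a b : ι) (x : Fin n → ι) :
    wordPf w (n + 2) (Fin.cons a (Fin.cons b x)) =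
      -wordPf w (n + 2) (Fin.cons b (Fin.cons a x)) := by
  rw [← wordPf_comp_swap hw _ (Fin.succ_ne_zero (0 : Fin (n + 1)))]
  congr 1
  funext k
  induction k using Fin.cases with
  | zero => simp
  | succ k =>
    induction k using Fin.cases with
    | zero => simp
    | succ k =>
      rw [Function.comp_apply, Equiv.swap_apply_of_ne_of_ne (by simp [Fin.ext_iff])
        (Fin.succ_ne_zero _)]
      simp

theorem wordPf_cons_cons_cons (hw : ∀ a b, w a b = -w b a) {n : ℕ} (a b c : ι) (x : Fin n → ι) :
    wordPf w (n + 3) (Fin.cons a (Fin.cons b (Fin.cons c x))) =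
      -wordPf w (n + 3) (Fin.cons a (Fin.cons c (Fin.cons b x))) := by
  have hne : (0 : Fin (n + 2)).succ ≠ (0 : Fin (n + 1)).succ.succ :=
    fun h => Fin.succ_ne_zero _ (Fin.succ_injective _ h).symm
  rw [← wordPf_comp_swap hw _ hne]
  congr 1
  funext k
  induction k using Fin.cases with
  | zero =>
    rw [Function.comp_apply, Equiv.swap_apply_of_ne_of_ne (Fin.succ_ne_zero _).symm
      (Fin.succ_ne_zero _).symm]
    simp
  | succ k =>
    induction k using Fin.cases with
    | zero =>
      rw [Function.comp_apply, Equiv.swap_apply_left]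
      rfl
    | succ k =>
      induction k using Fin.cases with
      | zero =>
        rw [Function.comp_apply, Equiv.swap_apply_right]
        rfl
      | succ k =>
        rw [Function.comp_apply, Equiv.swap_apply_of_ne_of_ne
          (fun h => Fin.succ_ne_zero _ (Fin.succ_injective _ h))
          (fun h => Fin.succ_ne_zero _ (Fin.succ_injective _ (Fin.succ_injective _ h)))]
        simp

theorem wordPf_snoc (hw : ∀ a b, w a b = -w b a) {n : ℕ} (x : Fin n → ι) (a : ι) :
    wordPf w (n + 1) (Fin.snoc x a) = (-1) ^ n * wordPf w (n + 1) (Fin.cons a x) := by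
  rw [Fin.snoc_eq_cons_rotate]
  refine (wordPf_comp_perm hw (Fin.cons a x : Fin (n + 1) → ι) (finRotate (n + 1))).trans ?_
  rw [sign_finRotate]
  simp

theorem wordPf_cons_snoc (hw : ∀ a b, w a b = -w b a) {n : ℕ} (x : Fin n → ι) (a b : ι) :
    wordPf w (n + 2) (Fin.cons a (Fin.snoc x b)) =
      (-1) ^ n * wordPf w (n + 2) (Fin.cons a (Fin.cons b x)) := by
  rw [Fin.cons_snoc_eq_snoc_cons, wordPf_snoc hw, wordPf_cons_cons hw]
  ring

theorem wordPf_cons_cons_snoc (hw : ∀ a b, w a b = -w b a) {n : ℕ} (x : Fin n → ι) (a b c : ι) :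
    wordPf w (n + 3) (Fin.cons a (Fin.cons b (Fin.snoc x c))) =
      (-1) ^ n * wordPf w (n + 3) (Fin.cons a (Fin.cons b (Fin.cons c x))) := by
  rw [Fin.cons_snoc_eq_snoc_cons, wordPf_cons_snoc hw, wordPf_cons_cons_cons hw]
  ring

theorem wordPf_snoc_snoc (hw : ∀ a b, w a b = -w b a) {n : ℕ} (x : Fin n → ι) (a b : ι) :
    wordPf w (n + 2) (Fin.snoc (Fin.snoc x a : Fin (n + 1) → ι) b) =
      wordPf w (n + 2) (Fin.cons a (Fin.cons b x)) := by
  rw [wordPf_snoc hw, wordPf_cons_snoc hw, wordPf_cons_cons hw, ← mul_assoc, ← pow_add]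
  simp [Odd.neg_one_pow (show Odd (n + 1 + n) from ⟨n, by ring⟩)]

theorem wordPf_cons_snoc_snoc (hw : ∀ a b, w a b = -w b a) {n : ℕ} (x : Fin n → ι) (a b c : ι) :
    wordPf w (n + 3) (Fin.cons a (Fin.snoc (Fin.snoc x b : Fin (n + 1) → ι) c)) =
      wordPf w (n + 3) (Fin.cons a (Fin.cons b (Fin.cons c x))) := by
  rw [Fin.cons_snoc_eq_snoc_cons, Fin.cons_snoc_eq_snoc_cons, wordPf_snoc_snoc hw,
    wordPf_cons_cons_cons hw, wordPf_cons_cons hw, neg_neg]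

theorem wordPf_cons_cons_snoc_snoc (hw : ∀ a b, w a b = -w b a) {n : ℕ} (x : Fin n → ι)
    (a b c d : ι) :
    wordPf w (n + 4) (Fin.cons a (Fin.cons b (Fin.snoc (Fin.snoc x c : Fin (n + 1) → ι) d))) =
      wordPf w (n + 4) (Fin.cons c (Fin.cons d (Fin.cons a (Fin.cons b x)))) := by
  rw [Fin.cons_snoc_eq_snoc_cons, Fin.cons_snoc_eq_snoc_cons, Fin.cons_snoc_eq_snoc_cons,
    Fin.cons_snoc_eq_snoc_cons, wordPf_snoc_snoc hw]

theorem sum_wordPf_mul_wordPf (hw : ∀ a b, w a b = -w b a) {m n : ℕ} (x : Fin (m + 1) → ι)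
    (y : Fin (n + 1) → ι) :
    ∑ i : Fin (m + 1), (-1) ^ (i : ℕ) * wordPf w m (fun k => x (i.succAbove k)) *
        wordPf w (n + 2) (Fin.cons (x i) y) +
      ∑ j : Fin (n + 1), (-1) ^ (j : ℕ) * wordPf w n (fun k => y (j.succAbove k)) *
        wordPf w (m + 2) (Fin.cons (y j) x) = 0 := by
  simp only [wordPf_cons, Finset.mul_sum]
  rw [Finset.sum_comm, ← Finset.sum_add_distrib]
  refine Finset.sum_eq_zero fun j _ => ?_
  rw [← Finset.sum_add_distrib]
  refine Finset.sum_eq_zero fun i _ => ?_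
  rw [hw (x i)]
  ring

theorem cons_succAbove_succ {n : ℕ} (a : ι) (y : Fin (n + 1) → ι) (q : Fin (n + 1)) :
    (fun k => (Fin.cons a y : Fin (n + 2) → ι) (q.succ.succAbove k)) =
      Fin.cons a (fun k => y (q.succAbove k)) := by
  funext k
  induction k using Fin.cases <;> simp

theorem cons_succAbove_zero {n : ℕ} (a : ι) (y : Fin n → ι) :
    (fun k => (Fin.cons a y : Fin (n + 1) → ι) ((0 : Fin (n + 1)).succAbove k)) = y := by
  funext k
  simp

theorem wordPf_plucker_odd (hw : ∀ a b, w a b = -w b a) {n : ℕ} (x : Fin (n + 1) → ι)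
    (a b c d : ι) :
    wordPf w (n + 2) (Fin.cons a x) *
        wordPf w (n + 4) (Fin.cons b (Fin.cons c (Fin.cons d x))) -
      wordPf w (n + 2) (Fin.cons b x) *
        wordPf w (n + 4) (Fin.cons a (Fin.cons c (Fin.cons d x))) +
      wordPf w (n + 2) (Fin.cons c x) *
        wordPf w (n + 4) (Fin.cons a (Fin.cons b (Fin.cons d x))) -
      wordPf w (n + 2) (Fin.cons d x) *
        wordPf w (n + 4) (Fin.cons a (Fin.cons b (Fin.cons c x))) = 0 := by
  have h := sum_wordPf_mul_wordPf hw x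
    (Fin.cons a (Fin.cons b (Fin.cons c (Fin.cons d x))) : Fin (n + 5) → ι)
  rw [Finset.sum_eq_zero, zero_add, Fin.sum_univ_succ, Fin.sum_univ_succ, Fin.sum_univ_succ,
    Fin.sum_univ_succ, Finset.sum_eq_zero] at h
  · simp only [cons_succAbove_succ, cons_succAbove_zero, Fin.cons_succ, Fin.cons_zero,
      Fin.val_succ, Fin.val_zero] at h
    linear_combination h
  · intro j _
    simp only [Fin.cons_succ]
    rw [wordPf_cons_eq_zero_of_mem hw, mul_zero]
  · intro i _
    have h1 : wordPf w (n + 4 + 2) (Fin.cons (x i)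
        (Fin.cons a (Fin.cons b (Fin.cons c (Fin.cons d x))) : Fin (n + 5) → ι)) = 0 :=
      wordPf_eq_zero_of_eq hw _ (i := 0) (j := i.succ.succ.succ.succ.succ)
        (Fin.succ_ne_zero _).symm (by simp)
    rw [h1, mul_zero]

theorem wordPf_plucker_even (hw : ∀ a b, w a b = -w b a) {n : ℕ} (x : Fin n → ι)
    (a b c d : ι) :
    wordPf w n x * wordPf w (n + 4) (Fin.cons a (Fin.cons b (Fin.cons c (Fin.cons d x)))) -
      wordPf w (n + 2) (Fin.cons a (Fin.cons b x)) *
        wordPf w (n + 2) (Fin.cons c (Fin.cons d x)) +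
      wordPf w (n + 2) (Fin.cons a (Fin.cons c x)) *
        wordPf w (n + 2) (Fin.cons b (Fin.cons d x)) -
      wordPf w (n + 2) (Fin.cons a (Fin.cons d x)) *
        wordPf w (n + 2) (Fin.cons b (Fin.cons c x)) = 0 := by
  have h := sum_wordPf_mul_wordPf hw (Fin.cons a x : Fin (n + 1) → ι)
    (Fin.cons b (Fin.cons c (Fin.cons d x)) : Fin (n + 3) → ι)
  rw [Fin.sum_univ_succ, Finset.sum_eq_zero (s := Finset.univ (α := Fin n)), add_zero,
    Fin.sum_univ_succ, Fin.sum_univ_succ, Fin.sum_univ_succ,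
    Finset.sum_eq_zero (s := Finset.univ (α := Fin n))] at h
  · simp only [cons_succAbove_succ, cons_succAbove_zero, Fin.cons_succ, Fin.cons_zero,
      Fin.val_succ, Fin.val_zero] at h
    rw [wordPf_cons_cons hw b a, wordPf_cons_cons hw c a, wordPf_cons_cons hw d a] at h
    linear_combination h
  · intro j _
    have h1 : wordPf w (n + 2) (Fin.cons (x j) (Fin.cons a x : Fin (n + 1) → ι)) = 0 :=
      wordPf_eq_zero_of_eq hw _ (i := 0) (j := j.succ.succ) (Fin.succ_ne_zero _).symm (by simp)
    simp only [Fin.cons_succ]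
    rw [h1, mul_zero]
  · intro i _
    have h1 : wordPf w (n + 2 + 2) (Fin.cons (x i)
        (Fin.cons b (Fin.cons c (Fin.cons d x)) : Fin (n + 3) → ι)) = 0 :=
      wordPf_eq_zero_of_eq hw _ (i := 0) (j := i.succ.succ.succ.succ)
        (Fin.succ_ne_zero _).symm (by simp)
    simp only [Fin.cons_succ]
    rw [h1, mul_zero]

end wordPf

theorem hasDerivAt_wordPf_shift {ι : Type*} {W : ι → ι → ℝ → ℝ} {D : ι → ι} {t : ℝ}
    (hD : ∀ a b, HasDerivAt (W a b) (W (D a) b t + W a (D b) t) t) :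
    ∀ (n : ℕ) (x : Fin n → ι), HasDerivAt (fun s => wordPf (fun a b => W a b s) n x)
      (∑ k, wordPf (fun a b => W a b t) n (Function.update x k (D (x k)))) t
  | 0, x => by simpa [wordPf] using hasDerivAt_const t (1 : ℝ)
  | 1, x => by simpa [wordPf] using hasDerivAt_const t (0 : ℝ)
  | n + 2, x => by
      simp only [wordPf]
      have h := HasDerivAt.fun_sum (u := Finset.univ) fun (q : Fin (n + 1)) _ =>
        (((hD (x 0) (x q.succ)).const_mul ((-1) ^ (q : ℕ))).mul
          (hasDerivAt_wordPf_shift hD n (fun k => x (q.succAbove k).succ)))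
      refine h.congr_deriv ?_
      rw [Finset.sum_comm]
      refine Finset.sum_congr rfl fun q _ => ?_
      rw [Fin.sum_univ_succ, Fin.sum_univ_succAbove _ q]
      have e0 : (fun k => Function.update x 0 (D (x 0)) (q.succAbove k).succ) =
          fun k => x (q.succAbove k).succ := by
        funext k
        simp
      have e1 : (fun k => Function.update x q.succ (D (x q.succ)) (q.succAbove k).succ) =
          fun k => x (q.succAbove k).succ := by
        funext k
        simp
      have e2 : ∀ i, (fun k => Function.update x (q.succAbove i).succ
          (D (x (q.succAbove i).succ)) (q.succAbove k).succ) =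
          Function.update (fun k => x (q.succAbove k).succ) i (D (x (q.succAbove i).succ)) :=
        fun i => Function.update_comp_eq_of_injective x
          ((Fin.succ_injective _).comp Fin.succAbove_right_injective) i _
      have e3 : ∀ (i : Fin (n + 1)) v, Function.update x i.succ v 0 = x 0 :=
        fun i v => Function.update_of_ne (Fin.succ_ne_zero i).symm _ _
      simp only [e0, e1, e2, e3]
      simp [Finset.mul_sum]
      ring

/-- The letters labelling rows of the bordered moment matrices: `idx i` is the `i`-th moment row,
`mark k` is the border with entries `α_{i+k}`, and `null` is a zero row. -/
inductive MomentLetter where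
  | null : MomentLetter
  | mark (k : ℕ) : MomentLetter
  | idx (i : ℕ) : MomentLetter

namespace MomentLetter

/-- The index shift on letters; borders are sent to the zero row. -/
def shift : MomentLetter → MomentLetter
  | null => null
  | mark _ => null
  | idx i => idx (i + 1)

/-- The entry of the bordered moment matrix at a pair of letters. -/
def pairing (m : ℕ → ℕ → ℝ → ℝ) (α : ℕ → ℝ → ℝ) : MomentLetter → MomentLetter → ℝ → ℝ
  | mark k, idx i => α (i + k)
  | idx i, mark k => -α (i + k)
  | idx i, idx j => m i j
  | _, _ => 0

/-- The word `idx 0, …, idx (n - 1)`. -/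
def idxWord (n : ℕ) : Fin n → MomentLetter := fun i => idx i

theorem idxWord_succ (n : ℕ) : idxWord (n + 1) = Fin.snoc (idxWord n) (idx n) := by
  funext k
  induction k using Fin.lastCases <;> simp [idxWord]

theorem exists_idxWord_apply (n : ℕ) (k : Fin n) : ∃ i, idxWord n k = idx i := ⟨k, rfl⟩

theorem exists_snoc_idxWord_apply (n j : ℕ) (k : Fin (n + 1)) :
    ∃ i, (Fin.snoc (idxWord n) (idx j) : Fin (n + 1) → MomentLetter) k = idx i := by
  induction k using Fin.lastCases <;> simp [idxWord]

variable {m : ℕ → ℕ → ℝ → ℝ} {α : ℕ → ℝ → ℝ}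

theorem pairing_skew (hskew : ∀ i j t, m i j t = -m j i t) (t : ℝ) (a b : MomentLetter) :
    pairing m α a b t = -pairing m α b a t := by
  cases a <;> cases b <;> simp [pairing]
  exact hskew _ _ _

theorem hasDerivAt_pairing (hm : ∀ i j t, HasDerivAt (m i j) (m (i + 1) j t + m i (j + 1) t) t)
    (hα : ∀ i t, HasDerivAt (α i) (α (i + 1) t) t) (t : ℝ) (a b : MomentLetter) :
    HasDerivAt (pairing m α a b)
      (pairing m α (shift a) b t + pairing m α a (shift b) t) t := by
  cases a <;> cases b <;> simp only [pairing, shift, Pi.zero_apply, add_zero, zero_add]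
  case mark.idx k i =>
    rw [Nat.add_right_comm]
    exact hα _ t
  case idx.mark i k =>
    rw [Nat.add_right_comm]
    exact (hα _ t).neg
  case idx.idx i j => exact hm i j t
  all_goals exact hasDerivAt_const t (0 : ℝ)

theorem pairing_mark_idx (k i : ℕ) : pairing m α (mark k) (idx i) = α (i + k) := rfl

theorem pairing_idx_mark (i k : ℕ) : pairing m α (idx i) (mark k) = -α (i + k) := rfl

theorem pairing_idx_idx (i j : ℕ) : pairing m α (idx i) (idx j) = m i j := rfl

theorem pairing_mark_mark (k l : ℕ) : pairing m α (mark k) (mark l) = 0 := rfl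

theorem hasDerivAt_wordPf_idx (hskew : ∀ i j t, m i j t = -m j i t)
    (hm : ∀ i j t, HasDerivAt (m i j) (α (i + 1) t * α j t - α i t * α (j + 1) t) t) (t : ℝ) :
    ∀ (n : ℕ) (x : Fin n → MomentLetter), (∀ k, ∃ i, x k = idx i) →
      HasDerivAt (fun s => wordPf (fun a b => pairing m α a b s) n x)
        (wordPf (fun a b => pairing m α a b t) (n + 2)
          (Fin.cons (mark 0) (Fin.cons (mark 1) x))) t
  | 0, x, _ => by simpa [wordPf, pairing] using hasDerivAt_const t (1 : ℝ)
  | 1, x, _ => (hasDerivAt_const t (0 : ℝ)).congr_deriv (wordPf_odd 1 _).symm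
  | n + 2, x, hx => by
      have hw := pairing_skew (α := α) hskew t
      choose a ha using hx
      obtain rfl : x = fun k => idx (a k) := funext ha
      have hsplit : (fun k => idx (a k) : Fin (n + 2) → MomentLetter) =
          Fin.cons (idx (a 0)) (fun k : Fin (n + 1) => idx (a k.succ)) := by
        funext k
        induction k using Fin.cases <;> simp
      rw [hsplit, wordPf_cons_cons_cons hw, wordPf_cons_cons hw, neg_neg]
      simp only [wordPf_cons (idx (a 0))]
      rw [Fin.sum_univ_succ, Fin.sum_univ_succ]
      simp only [cons_succAbove_succ, cons_succAbove_zero, Fin.cons_succ, Fin.cons_zero,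
        Fin.val_succ, Fin.val_zero]
      rw [wordPf_cons (mark 1), wordPf_cons (mark 0)]
      have h := HasDerivAt.fun_sum (u := Finset.univ) fun (q : Fin (n + 1)) _ =>
        (((hm (a 0) (a q.succ) t).const_mul ((-1) ^ (q : ℕ))).mul
          (hasDerivAt_wordPf_idx hskew hm t n (fun k => idx (a (q.succAbove k).succ))
            (fun k => ⟨_, rfl⟩)))
      refine h.congr_deriv ?_
      rw [Finset.mul_sum, Finset.mul_sum, ← Finset.sum_add_distrib, ← Finset.sum_add_distrib]
      refine Finset.sum_congr rfl fun q _ => ?_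
      simp only [pairing_mark_idx, pairing_idx_mark, pairing_idx_idx, add_zero, Pi.neg_apply]
      ring

theorem hasDerivAt_wordPf_mark_idx (hskew : ∀ i j t, m i j t = -m j i t)
    (hm : ∀ i j t, HasDerivAt (m i j) (α (i + 1) t * α j t - α i t * α (j + 1) t) t)
    (hα : ∀ i t, HasDerivAt (α i) (α (i + 1) t) t) (t : ℝ) (n : ℕ)
    (x : Fin (n + 1) → MomentLetter) (hx : ∀ k, ∃ i, x k = idx i) :
    HasDerivAt (fun s => wordPf (fun a b => pairing m α a b s) (n + 2) (Fin.cons (mark 0) x))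
      (wordPf (fun a b => pairing m α a b t) (n + 2) (Fin.cons (mark 1) x)) t := by
  have hw := pairing_skew (α := α) hskew t
  choose a ha using hx
  obtain rfl : x = fun k => idx (a k) := funext ha
  have h := HasDerivAt.fun_sum (u := Finset.univ) fun (q : Fin (n + 1)) _ =>
    (((hα (a q) t).const_mul ((-1) ^ (q : ℕ))).mul
      (hasDerivAt_wordPf_idx hskew hm t n (fun k => idx (a (q.succAbove k))) (fun k => ⟨_, rfl⟩)))
  have h0 : wordPf (fun a b => pairing m α a b t) (n + 4) (Fin.cons (mark 0)
      (Fin.cons (mark 0) (Fin.cons (mark 1) (fun k => idx (a k))))) = 0 :=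
    wordPf_eq_zero_of_eq hw _ (i := 0) (j := (0 : Fin (n + 3)).succ) (Fin.succ_ne_zero _).symm rfl
  rw [wordPf_cons, Fin.sum_univ_succ, Fin.sum_univ_succ] at h0
  simp only [cons_succAbove_succ, cons_succAbove_zero, Fin.cons_succ,
    Fin.cons_zero, Fin.val_succ, Fin.val_zero] at h0
  simp only [wordPf_cons]
  refine h.congr_deriv ?_
  rw [Finset.sum_add_distrib]
  simp only [pairing_mark_idx, pairing_mark_mark, Pi.zero_apply, add_zero, mul_zero, zero_mul,
    zero_add, pow_succ, mul_neg, mul_one, neg_neg] at h0 ⊢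
  rw [h0, add_zero]

theorem hasDerivAt_wordPf_idxWord (hskew : ∀ i j t, m i j t = -m j i t)
    (hm : ∀ i j t, HasDerivAt (m i j) (m (i + 1) j t + m i (j + 1) t) t)
    (hα : ∀ i t, HasDerivAt (α i) (α (i + 1) t) t) (t : ℝ) (n : ℕ) :
    HasDerivAt (fun s => wordPf (fun a b => pairing m α a b s) (n + 1) (idxWord (n + 1)))
      (wordPf (fun a b => pairing m α a b t) (n + 1) (Fin.snoc (idxWord n) (idx (n + 1)))) t := by
  have hw := pairing_skew (α := α) hskew t
  refine (hasDerivAt_wordPf_shift (hasDerivAt_pairing hm hα t) _ _).congr_deriv ?_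
  rw [Fin.sum_univ_castSucc, Finset.sum_eq_zero, zero_add]
  · rw [idxWord_succ]
    simp only [Fin.snoc_last, shift, Fin.update_snoc_last]
  · intro k _
    refine wordPf_eq_zero_of_eq hw _ (Fin.castSucc_lt_succ (i := k)).ne ?_
    rw [Function.update_self, Function.update_of_ne (Fin.castSucc_lt_succ (i := k)).ne']
    simp [idxWord, shift]

theorem hasDerivAt_wordPf_mark_idxWord (hskew : ∀ i j t, m i j t = -m j i t)
    (hm : ∀ i j t, HasDerivAt (m i j) (m (i + 1) j t + m i (j + 1) t) t)
    (hα : ∀ i t, HasDerivAt (α i) (α (i + 1) t) t) (t : ℝ) (n : ℕ) :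
    HasDerivAt (fun s => wordPf (fun a b => pairing m α a b s) (n + 2)
        (Fin.cons (mark 0) (idxWord (n + 1))))
      (wordPf (fun a b => pairing m α a b t) (n + 2)
        (Fin.cons (mark 0) (Fin.snoc (idxWord n) (idx (n + 1))))) t := by
  have hw := pairing_skew (α := α) hskew t
  refine (hasDerivAt_wordPf_shift (hasDerivAt_pairing hm hα t) _ _).congr_deriv ?_
  rw [Fin.sum_univ_succ, Fin.sum_univ_castSucc,
    Finset.sum_eq_zero (s := Finset.univ (α := Fin n)), zero_add]
  · have h0 : wordPf (fun a b => pairing m α a b t) (n + 2)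
        (Fin.cons null (idxWord (n + 1))) = 0 := by
      rw [wordPf_cons]
      simp [pairing]
    simp only [Fin.cons_zero, Fin.cons_succ, shift, Fin.update_cons_zero, h0, zero_add,
      ← Fin.cons_update]
    rw [idxWord_succ]
    simp only [Fin.snoc_last, Fin.update_snoc_last]
  · intro k _
    refine wordPf_eq_zero_of_eq hw _ (i := k.castSucc.succ) (j := k.succ.succ)
      (fun h => (Fin.castSucc_lt_succ (i := k)).ne (Fin.succ_injective _ h)) ?_
    rw [Function.update_self, Function.update_of_ne
      (fun h => (Fin.castSucc_lt_succ (i := k)).ne (Fin.succ_injective _ h).symm)]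
    simp [idxWord, shift]

theorem tauhatT_even (hskew : ∀ i j t, m i j t = -m j i t) (N : ℕ) :
    tauhatT m α (2 * N) =
      fun t => wordPf (fun a b => pairing m α a b t) (2 * N) (idxWord (2 * N)) := by
  funext t
  rw [← pfaffian_eq_wordPf (pairing_skew hskew t)]
  simp only [tauhatT, Nat.mul_mod_right, if_true]
  rw [Nat.mul_div_cancel_left N (by norm_num : 0 < 2)]
  rfl

theorem tauhatT_odd (hskew : ∀ i j t, m i j t = -m j i t) (N : ℕ) :
    tauhatT m α (2 * N + 1) =
      fun t => wordPf (fun a b => pairing m α a b t) (2 * N + 2)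
        (Fin.cons (mark 0) (idxWord (2 * N + 1))) := by
  funext t
  have h1 : (2 * N + 1) % 2 ≠ 0 := by omega
  have h2 : (2 * N + 1) / 2 = N := by omega
  refine Eq.trans ?_ (pfaffian_eq_wordPf (pairing_skew (α := α) hskew t) (N + 1)
    (Fin.cons (mark 0) (idxWord (2 * N + 1)) : Fin (2 * N + 2) → MomentLetter))
  rw [tauhatT, if_neg h1, h2, tauOddT]
  congr 1
  ext i j
  change Fin (2 * N + 1 + 1) at i j
  induction i using Fin.cases <;> induction j using Fin.cases <;> simp [pairing, idxWord]

end MomentLetter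

/-- B-Toda lattice: for skew-symmetric moments evolving by
`∂ₜ m_{i,j} = m_{i+1,j} + m_{i,j+1}`, `∂ₜ α_i = α_{i+1}` and subject to the rank two shift
condition `m_{i+1,j} + m_{i,j+1} = α_{i+1}α_j − α_iα_{j+1}`, the Pfaffian tau functions
satisfy `τ̂ₙ″·τ̂ₙ − (τ̂ₙ′)² = τ̂_{n−1}′·τ̂_{n+1} − τ̂_{n−1}·τ̂_{n+1}′` for all `n ≥ 1`
(Hirota form: `D² τ̂ₙ·τ̂ₙ = 2 D τ̂_{n−1}·τ̂_{n+1}`). -/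
theorem stmt14 (m : ℕ → ℕ → ℝ → ℝ) (α : ℕ → ℝ → ℝ)
    (hskew : ∀ i j t, m i j t = -m j i t)
    (hm2 : ∀ i j, ContDiff ℝ 2 (m i j))
    (hα2 : ∀ i, ContDiff ℝ 2 (α i))
    (hmder : ∀ i j t, deriv (m i j) t = m (i + 1) j t + m i (j + 1) t)
    (hαder : ∀ i t, deriv (α i) t = α (i + 1) t)
    (hrank2 : ∀ i j t, m (i + 1) j t + m i (j + 1) t =
      α (i + 1) t * α j t - α i t * α (j + 1) t) :
    ∀ n : ℕ, 1 ≤ n → ∀ t : ℝ,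
      deriv (deriv (tauhatT m α n)) t * tauhatT m α n t -
          (deriv (tauhatT m α n) t) ^ 2 =
        deriv (tauhatT m α (n - 1)) t * tauhatT m α (n + 1) t -
          tauhatT m α (n - 1) t * deriv (tauhatT m α (n + 1)) t := by
  intro n hn t
  obtain ⟨k, rfl⟩ : ∃ k, n = k + 1 := ⟨n - 1, by omega⟩
  have hm : ∀ i j t, HasDerivAt (m i j) (m (i + 1) j t + m i (j + 1) t) t := fun i j t => by
    rw [← hmder]
    exact ((hm2 i j).differentiable (by norm_num) t).hasDerivAt
  have hm' : ∀ i j t, HasDerivAt (m i j) (α (i + 1) t * α j t - α i t * α (j + 1) t) t :=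
    fun i j t => hrank2 i j t ▸ hm i j t
  have hα : ∀ i t, HasDerivAt (α i) (α (i + 1) t) t := fun i t => by
    rw [← hαder]
    exact ((hα2 i).differentiable (by norm_num) t).hasDerivAt
  have hw := MomentLetter.pairing_skew (α := α) hskew t
  rw [Nat.add_sub_cancel]
  obtain ⟨N, rfl | rfl⟩ := Nat.even_or_odd' k
  · have hd := deriv_eq fun s =>
      MomentLetter.hasDerivAt_wordPf_mark_idxWord hskew hm hα s (2 * N)
    have hd' := (MomentLetter.hasDerivAt_wordPf_mark_idx hskew hm' hα t (2 * N) _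
      (MomentLetter.exists_idxWord_apply _)).deriv
    have hdd := (MomentLetter.hasDerivAt_wordPf_mark_idx hskew hm' hα t (2 * N) _
      (MomentLetter.exists_snoc_idxWord_apply (2 * N) (2 * N + 1))).deriv
    have hd0 := (MomentLetter.hasDerivAt_wordPf_idx hskew hm' t _ _
      (MomentLetter.exists_idxWord_apply (2 * N))).deriv
    have hd2 := (MomentLetter.hasDerivAt_wordPf_idx hskew hm' t _ _
      (MomentLetter.exists_idxWord_apply (2 * N + 2))).deriv
    have hdt := (congrFun hd t).symm.trans hd'
    have htau : tauhatT m α (2 * N + 1 + 1) = _ := MomentLetter.tauhatT_even hskew (N + 1)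
    simp only [Nat.mul_succ] at htau
    rw [htau, MomentLetter.tauhatT_even hskew, MomentLetter.tauhatT_odd hskew, hd, hdd, hd0, hd2,
      sq]
    beta_reduce
    nth_rewrite 1 [hdt]
    rw [MomentLetter.idxWord_succ (2 * N + 1), MomentLetter.idxWord_succ (2 * N),
      wordPf_cons_cons_snoc_snoc hw, wordPf_snoc_snoc hw]
    simp only [wordPf_cons_snoc hw, Even.neg_one_pow (even_two_mul N), one_mul]
    rw [wordPf_cons_cons hw (.mark 1) (.idx (2 * N)), wordPf_cons_cons hw (.mark 0) (.idx (2 * N)),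
      wordPf_cons_cons hw (.mark 1) (.idx (2 * N + 1)),
      wordPf_cons_cons hw (.mark 0) (.idx (2 * N + 1))]
    linear_combination wordPf_plucker_even hw (MomentLetter.idxWord (2 * N)) (.idx (2 * N))
      (.idx (2 * N + 1)) (.mark 0) (.mark 1)
  · have hd := deriv_eq fun s =>
      MomentLetter.hasDerivAt_wordPf_idxWord hskew hm hα s (2 * N + 1)
    have hd' := (MomentLetter.hasDerivAt_wordPf_idx hskew hm' t _ _
      (MomentLetter.exists_idxWord_apply (2 * N + 2))).deriv
    have hdd := (MomentLetter.hasDerivAt_wordPf_idx hskew hm' t _ _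
      (MomentLetter.exists_snoc_idxWord_apply (2 * N + 1) (2 * N + 2))).deriv
    have hd0 := (MomentLetter.hasDerivAt_wordPf_mark_idx hskew hm' hα t _ _
      (MomentLetter.exists_idxWord_apply (2 * N + 1))).deriv
    have hd2 := (MomentLetter.hasDerivAt_wordPf_mark_idx hskew hm' hα t _ _
      (MomentLetter.exists_idxWord_apply (2 * N + 3))).deriv
    have hdt := (congrFun hd t).symm.trans hd'
    have htau1 : tauhatT m α (2 * N + 1 + 1) = _ := MomentLetter.tauhatT_even hskew (N + 1)
    have htau2 : tauhatT m α (2 * N + 1 + 1 + 1) = _ := MomentLetter.tauhatT_odd hskew (N + 1)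
    simp only [Nat.mul_succ] at htau1 htau2
    rw [htau1, htau2, MomentLetter.tauhatT_odd hskew, hd, hdd, hd0, hd2, sq]
    beta_reduce
    nth_rewrite 1 [hdt]
    rw [MomentLetter.idxWord_succ (2 * N + 2), MomentLetter.idxWord_succ (2 * N + 1),
      wordPf_cons_snoc_snoc hw, wordPf_cons_snoc_snoc hw]
    simp only [wordPf_cons_cons_snoc hw, wordPf_snoc hw,
      Odd.neg_one_pow (odd_two_mul_add_one N)]
    linear_combination wordPf_plucker_odd hw (MomentLetter.idxWord (2 * N + 1)) (.mark 0)
      (.mark 1) (.idx (2 * N + 1)) (.idx (2 * N + 2))
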